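/- Unconditional stability of the semi-implicit scheme with solid correction (Algorithm 3) with extrapolation of order r = 0: Suppose (uᵐ)_{m≥0} ⊆ F, (dᵐ)_{m≥0} ⊆ W_h and ḋ⁰ ∈ W_h are given, set ḋᵐ = ∂_τ dᵐ for m ≥ 1, and suppose the nonnegative reals (δ_m)_{m≥1} are such that for every m ≥ 1 the tested scheme equation ρ_f⟨uᵐ − uᵐ⁻¹, uᵐ⟩_F + δ_m + ρ_s ε⟨ḋᵐ − ḋᵐ⁻¹, ḋ^{m−1/2}⟩_S + τ a(dᵐ, ḋ^{m−1/2}) = 0 holds, where ḋ^{m−1/2} = ḋᵐ + (τ/(ρ_s ε)) L_h dᵐ is the fractional-step solid velocity (extrapolation d^{m⋆} = 0). Then for every n ≥ 1: Eⁿ + Σ_{m=1}^{n} δ_m + τ² Σ_{m=1}^{n} [(ρ_f/2)‖∂_τ uᵐ‖_F² + (ρ_s ε/6)‖∂_τ ḋᵐ‖_S² + (1/2)‖∂_τ dᵐ‖_s²] + (τ²/(4ρ_s ε)) Σ_{m=1}^{n} ‖L_h dᵐ‖_S² ≤ E⁰, where Eᵐ = (ρ_f/2)‖uᵐ‖_F²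 + (ρ_s ε/2)‖ḋᵐ‖_S² + (1/2)‖dᵐ‖_s². No condition relating τ to the spaces is required. -/

import Mathlib

open RealInnerProductSpace

theorem real_inner_sub_self_eq {E : Type*} [NormedAddCommGroup E] [InnerProductSpace ℝ E]
    (x y : E) : ⟪x - y, x⟫ = 1 / 2 * (‖x‖ ^ 2 - ‖y‖ ^ 2 + ‖x - y‖ ^ 2) := by
  rw [norm_sub_sq_real, inner_sub_left, real_inner_self_eq_norm_sq, real_inner_comm]
  ring

/-- Young's inequality with the weights `k / 3` and `3 τ² / (4 k)`. -/
theorem neg_mul_real_inner_le_young {E : Type*} [NormedAddCommGroup E] [InnerProductSpace ℝ E]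
    {k : ℝ} (hk : 0 < k) (τ : ℝ) (x y : E) :
    -(τ * ⟪x, y⟫) ≤ k / 3 * ‖x‖ ^ 2 + 3 / 4 * (τ ^ 2 / k) * ‖y‖ ^ 2 := by
  have h : 0 ≤ k / 3 * ‖x + (3 * τ / (2 * k)) • y‖ ^ 2 := by positivity
  have e : k / 3 * ‖x + (3 * τ / (2 * k)) • y‖ ^ 2
      = k / 3 * ‖x‖ ^ 2 + τ * ⟪x, y⟫ + 3 / 4 * (τ ^ 2 / k) * ‖y‖ ^ 2 := by
    rw [norm_add_sq_real, norm_smul, mul_pow, Real.norm_eq_abs, sq_abs, real_inner_smul_right]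
    field_simp
    ring
  linarith

theorem sq_mul_norm_one_div_smul_sq {E : Type*} [NormedAddCommGroup E] [NormedSpace ℝ E]
    {τ : ℝ} (hτ : τ ≠ 0) (x : E) : τ ^ 2 * ‖(1 / τ) • x‖ ^ 2 = ‖x‖ ^ 2 := by
  rw [norm_smul, mul_pow, Real.norm_eq_abs, sq_abs]
  field_simp

theorem add_sum_Icc_le_of_step {E D : ℕ → ℝ} (h : ∀ m, 1 ≤ m → E m + D m ≤ E (m - 1)) (n : ℕ) :
    E n + ∑ m ∈ Finset.Icc 1 n, D m ≤ E 0 := by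
  induction n with
  | zero => simp
  | succ n ih =>
    have hn := h (n + 1) (by omega)
    rw [Nat.add_sub_cancel] at hn
    rw [Finset.sum_Icc_succ_top (by omega)]
    linarith

/-- Unconditional stability of the semi-implicit scheme with solid correction
(Algorithm 3) with extrapolation of order `r = 0` (`d^{m⋆} = 0`). -/
theorem algorithm3_unconditional_stability_order_zero
    {F S : Type*}
    [NormedAddCommGroup F] [InnerProductSpace ℝ F] [CompleteSpace F]
    [NormedAddCommGroup S] [InnerProductSpace ℝ S] [CompleteSpace S]
    (Wh : Submodule ℝ S) [FiniteDimensional ℝ Wh]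
    (a : S → S → ℝ)
    (hsymm : ∀ u ∈ Wh, ∀ v ∈ Wh, a u v = a v u)
    (hadd : ∀ u ∈ Wh, ∀ v ∈ Wh, ∀ w ∈ Wh, a (u + v) w = a u w + a v w)
    (hsmul : ∀ (c : ℝ), ∀ u ∈ Wh, ∀ w ∈ Wh, a (c • u) w = c * a u w)
    (hpos : ∀ w ∈ Wh, w ≠ 0 → 0 < a w w)
    (Lh : S → S)
    (hLh_mem : ∀ w ∈ Wh, Lh w ∈ Wh)
    (hLh : ∀ w ∈ Wh, ∀ z ∈ Wh, ⟪Lh w, z⟫ = a w z)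
    (ρf ρs ε τ : ℝ) (hρf : 0 < ρf) (hρs : 0 < ρs) (hε : 0 < ε) (hτ : 0 < τ)
    (u : ℕ → F) (d ddot : ℕ → S) (δ : ℕ → ℝ)
    (hd_mem : ∀ m, d m ∈ Wh) (hddot_mem : ∀ m, ddot m ∈ Wh)
    (hδ : ∀ m, 1 ≤ m → 0 ≤ δ m)
    (hddot : ∀ m, 1 ≤ m → ddot m = (1 / τ) • (d m - d (m - 1)))
    (hscheme : ∀ m, 1 ≤ m →
      ρf * ⟪u m - u (m - 1), u m⟫ + δ m
        + ρs * ε * ⟪ddot m - ddot (m - 1), ddot m + (τ / (ρs * ε)) • Lh (d m)⟫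
        + τ * a (d m) (ddot m + (τ / (ρs * ε)) • Lh (d m)) = 0) :
    ∀ n, 1 ≤ n →
      (ρf / 2 * ‖u n‖ ^ 2 + ρs * ε / 2 * ‖ddot n‖ ^ 2 + 1 / 2 * a (d n) (d n))
        + (∑ m ∈ Finset.Icc 1 n, δ m)
        + τ ^ 2 * ∑ m ∈ Finset.Icc 1 n,
            (ρf / 2 * ‖(1 / τ) • (u m - u (m - 1))‖ ^ 2
              + ρs * ε / 6 * ‖(1 / τ) • (ddot m - ddot (m - 1))‖ ^ 2
              + 1 / 2 * a ((1 / τ) • (d m - d (m - 1))) ((1 / τ) • (d m - d (m - 1))))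
        + (τ ^ 2 / (4 * ρs * ε)) * ∑ m ∈ Finset.Icc 1 n, ‖Lh (d m)‖ ^ 2
      ≤ ρf / 2 * ‖u 0‖ ^ 2 + ρs * ε / 2 * ‖ddot 0‖ ^ 2 + 1 / 2 * a (d 0) (d 0) := by
  intro n _
  have hk : 0 < ρs * ε := mul_pos hρs hε
  have hLself : ∀ m, a (d m) (Lh (d m)) = ‖Lh (d m)‖ ^ 2 := fun m => by
    rw [← hLh _ (hd_mem m) _ (hLh_mem _ (hd_mem m)), real_inner_self_eq_norm_sq]
  have hstep : ∀ m, 1 ≤ m →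
      (ρf / 2 * ‖u m‖ ^ 2 + ρs * ε / 2 * ‖ddot m‖ ^ 2 + 1 / 2 * a (d m) (d m))
        + (δ m
          + τ ^ 2 * (ρf / 2 * ‖(1 / τ) • (u m - u (m - 1))‖ ^ 2
              + ρs * ε / 6 * ‖(1 / τ) • (ddot m - ddot (m - 1))‖ ^ 2
              + 1 / 2 * a ((1 / τ) • (d m - d (m - 1))) ((1 / τ) • (d m - d (m - 1))))
          + (τ ^ 2 / (4 * ρs * ε)) * ‖Lh (d m)‖ ^ 2)
      ≤ ρf / 2 * ‖u (m - 1)‖ ^ 2 + ρs * ε / 2 * ‖ddot (m - 1)‖ ^ 2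
        + 1 / 2 * a (d (m - 1)) (d (m - 1)) := by
    intro m hm
    have hs := hscheme m hm
    have hx := hd_mem m
    have hy := hd_mem (m - 1)
    have hxy : d m - d (m - 1) ∈ Wh := Wh.sub_mem hx hy
    have hLx := hLh_mem _ hx
    have hsplit : ∀ w ∈ Wh, a (d m) w = a (d m - d (m - 1)) w + a (d (m - 1)) w := by
      intro w hw
      rw [← hadd _ hxy _ hy _ hw, sub_add_cancel]
    have hsplit_x := hsplit _ hx
    have hsplit_y := hsplit _ hy
    have hsplit_xy := hsplit _ hxy
    have hcomm_x := hsymm _ hx _ hxy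
    have hcomm_y := hsymm _ hy _ hxy
    have hcomm := hsymm _ hx _ hy
    have hpolar : a (d m) (d m - d (m - 1)) = 1 / 2 * (a (d m) (d m)
        - a (d (m - 1)) (d (m - 1)) + a (d m - d (m - 1)) (d m - d (m - 1))) := by
      linarith
    have hscale : τ ^ 2 * a ((1 / τ) • (d m - d (m - 1))) ((1 / τ) • (d m - d (m - 1)))
        = a (d m - d (m - 1)) (d m - d (m - 1)) := by
      rw [hsmul _ _ hxy _ (Wh.smul_mem _ hxy), hsymm _ hxy _ (Wh.smul_mem _ hxy),
        hsmul _ _ hxy _ hxy]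
      field_simp
    have helastic : τ * a (d m) (ddot m + (τ / (ρs * ε)) • Lh (d m))
        = a (d m) (d m - d (m - 1)) + τ ^ 2 / (ρs * ε) * ‖Lh (d m)‖ ^ 2 := by
      rw [← hLh _ hx _ (Wh.add_mem (hddot_mem m) (Wh.smul_mem _ hLx)), ← hLh _ hx _ hxy,
        inner_add_right, real_inner_smul_right, real_inner_self_eq_norm_sq, hddot m hm,
        real_inner_smul_right]
      field_simp
    have hinertia : ρs * ε * ⟪ddot m - ddot (m - 1), ddot m + (τ / (ρs * ε)) • Lh (d m)⟫
        = ρs * ε * ⟪ddot m - ddot (m - 1), ddot m⟫ + τ * ⟪ddot m - ddot (m - 1), Lh (d m)⟫ := by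
      rw [inner_add_right, real_inner_smul_right]
      field_simp
    have hyoung := neg_mul_real_inner_le_young hk τ (ddot m - ddot (m - 1)) (Lh (d m))
    have hcoef : τ ^ 2 / (4 * ρs * ε) = 1 / 4 * (τ ^ 2 / (ρs * ε)) := by field_simp
    have hu := sq_mul_norm_one_div_smul_sq hτ.ne' (u m - u (m - 1))
    have hv := sq_mul_norm_one_div_smul_sq hτ.ne' (ddot m - ddot (m - 1))
    rw [helastic, hinertia, hpolar, real_inner_sub_self_eq, real_inner_sub_self_eq] at hs
    rw [hcoef]
    linear_combination hs + hyoung + ρf / 2 * hu + ρs * ε / 6 * hv + 1 / 2 * hscale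
  have h := add_sum_Icc_le_of_step
    (E := fun m => ρf / 2 * ‖u m‖ ^ 2 + ρs * ε / 2 * ‖ddot m‖ ^ 2 + 1 / 2 * a (d m) (d m))
    hstep n
  rw [Finset.sum_add_distrib, Finset.sum_add_distrib, ← Finset.mul_sum, ← Finset.mul_sum] at h
  linarith
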